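/- arXiv:2011.08476 — 2 statements merged into one kernel-verified Lean document; each statement's English description precedes it below -/
import Mathlib

section
/- Let ℓ be an odd prime, G̃ a finite group with center Z̃, and G a normal subgroup of G̃ such that G ∩ Z̃ = Z(G) has order 2 and the subgroup G·Z̃ has index 2 in G̃. Then every ℓ-radical subgroup R̃ of G̃ satisfies R̃ = (G ∩ R̃) · O_ℓ(Z̃), where O_ℓ(Z̃) is the subgroup of elements of Z̃ of ℓ-power order; and the map R̃ ↦ G ∩ R̃ is a bijection from the set of ℓ-radical subgroups of G̃ onto the set of ℓ-radical subgroups of G. -/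
/-- An `ℓ`-radical subgroup of a group `X`: an `ℓ`-subgroup `R` such that `R = O_ℓ(N_X(R))`,
i.e. every normal `ℓ`-subgroup of the normalizer `N_X(R)` is contained in `R`. -/
def IsRadicalPSubgroup (ℓ : ℕ) {X : Type*} [Group X] (R : Subgroup X) : Prop :=
  IsPGroup ℓ R ∧
    ∀ P : Subgroup X, P ≤ Subgroup.normalizer (R : Set X) → IsPGroup ℓ P →
      (∀ n ∈ Subgroup.normalizer (R : Set X), ∀ p ∈ P, n * p * n⁻¹ ∈ P) → P ≤ R

/-- An `ℓ`-radical subgroup of a subgroup `G` of `X`: an `ℓ`-subgroup `R ≤ G` such that every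
normal `ℓ`-subgroup of `N_G(R) = G ∩ N_X(R)` is contained in `R`. -/
def IsRadicalPSubgroupIn (ℓ : ℕ) {X : Type*} [Group X] (G R : Subgroup X) : Prop :=
  R ≤ G ∧ IsPGroup ℓ R ∧
    ∀ P : Subgroup X, P ≤ G ⊓ Subgroup.normalizer (R : Set X) → IsPGroup ℓ P →
      (∀ n ∈ G ⊓ Subgroup.normalizer (R : Set X), ∀ p ∈ P, n * p * n⁻¹ ∈ P) → P ≤ R
open Subgroup in
theorem aux_le_normalizer {X : Type*} [Group X] {K P : Subgroup X}
    (h : ∀ n ∈ K, ∀ p ∈ P, n * p * n⁻¹ ∈ P) : K ≤ Subgroup.normalizer (P : Set X) := by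
  intro n hn
  rw [Subgroup.mem_normalizer_iff]
  intro x
  refine ⟨h n hn x, fun hx => ?_⟩
  have := h n⁻¹ (K.inv_mem hn) _ hx
  simpa [mul_assoc] using this

theorem aux_pgroup_iff {ℓ : ℕ} {X : Type*} [Group X] {P : Subgroup X} :
    IsPGroup ℓ P ↔ ∀ x ∈ P, ∃ k : ℕ, x ^ ℓ ^ k = 1 := by
  constructor
  · intro h x hx
    obtain ⟨k, hk⟩ := h ⟨x, hx⟩
    exact ⟨k, by simpa using congrArg Subtype.val hk⟩
  · rintro h ⟨x, hx⟩
    obtain ⟨k, hk⟩ := h x hx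
    exact ⟨k, Subtype.ext (by simpa using hk)⟩

/-- A normal `ℓ`-subgroup of `K` is contained in one that is stable under everything
normalizing `K`. -/
theorem aux_core {ℓ : ℕ} {X : Type*} [Group X] [Finite X] (K P : Subgroup X)
    (hPK : P ≤ K) (hP : IsPGroup ℓ P) (hPn : ∀ n ∈ K, ∀ p ∈ P, n * p * n⁻¹ ∈ P) :
    ∃ Q : Subgroup X, P ≤ Q ∧ Q ≤ K ∧ IsPGroup ℓ Q ∧
      ∀ n ∈ Subgroup.normalizer (K : Set X), ∀ p ∈ Q, n * p * n⁻¹ ∈ Q := by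
  let A : Set (Subgroup X) := {Q | Q ≤ K ∧ IsPGroup ℓ Q ∧ K ≤ Subgroup.normalizer (Q : Set X)}
  obtain ⟨Q, hPQ, hQ⟩ := (Set.toFinite A).exists_le_maximal
    (show P ∈ A from ⟨hPK, hP, aux_le_normalizer hPn⟩)
  obtain ⟨⟨hQK, hQp, hQn⟩, hmax⟩ := hQ
  refine ⟨Q, hPQ, hQK, hQp, fun n hn p hp => ?_⟩
  let T : Subgroup X := Q.map (MulAut.conj n).toMonoidHom
  have hTmem : ∀ y, y ∈ T ↔ n⁻¹ * y * n ∈ Q := by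
    intro y
    constructor
    · rintro ⟨q, hq, rfl⟩
      simpa [mul_assoc] using hq
    · intro hy
      exact ⟨_, hy, by simp [mul_assoc]⟩
  have hnK := Subgroup.mem_normalizer_iff''.1 hn
  have hTK : T ≤ K := fun y hy => (hnK y).2 (hQK ((hTmem y).1 hy))
  have hTp : IsPGroup ℓ T := hQp.map _
  have hTn : K ≤ Subgroup.normalizer (T : Set X) := by
    apply aux_le_normalizer
    intro k hk t ht
    rw [hTmem] at ht ⊢
    have := (Subgroup.mem_normalizer_iff.1 (hQn ((hnK k).1 hk)) _).1 ht
    simpa [mul_assoc] using this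
  have hsup : Q ⊔ T ∈ A :=
    ⟨sup_le hQK hTK, hQp.to_sup_of_normal_right' hTp (hQK.trans hTn),
      (le_inf hQn hTn).trans (Subgroup.normalizer_inf_normalizer_le_normalizer_sup Q T)⟩
  refine hmax hsup le_sup_left (Subgroup.mem_sup_right ((hTmem _).2 ?_))
  simpa [mul_assoc] using hp

/-- The subgroup `O_ℓ(Z(X))`. -/
def auxO (ℓ : ℕ) (X : Type*) [Group X] : Subgroup X where
  carrier := {z | z ∈ Subgroup.center X ∧ ∃ k : ℕ, z ^ ℓ ^ k = 1}
  one_mem' := ⟨Subgroup.one_mem _, 0, by simp⟩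
  mul_mem' := by
    rintro a b ⟨ha, k, hk⟩ ⟨hb, j, hj⟩
    refine ⟨Subgroup.mul_mem _ ha hb, k + j, ?_⟩
    have hc : Commute a b := (Subgroup.mem_center_iff.1 ha b).symm
    rw [hc.mul_pow, pow_add, pow_mul, hk, one_pow, mul_comm (ℓ ^ k), pow_mul, hj, one_pow, one_mul]
  inv_mem' := by
    rintro a ⟨ha, k, hk⟩
    exact ⟨Subgroup.inv_mem _ ha, k, by rw [inv_pow, hk, inv_one]⟩

theorem aux_mem_O {ℓ : ℕ} {X : Type*} [Group X] {z : X} :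
    z ∈ auxO ℓ X ↔ z ∈ Subgroup.center X ∧ ∃ k : ℕ, z ^ ℓ ^ k = 1 := Iff.rfl

instance auxO_normal (ℓ : ℕ) (X : Type*) [Group X] : (auxO ℓ X).Normal where
  conj_mem := by
    intro z hz g
    have : g * z * g⁻¹ = z := by
      rw [Subgroup.mem_center_iff.1 hz.1 g, mul_inv_cancel_right]
    rwa [this]

theorem auxO_pgroup (ℓ : ℕ) (X : Type*) [Group X] : IsPGroup ℓ (auxO ℓ X) :=
  aux_pgroup_iff.2 fun _ hx => hx.2

theorem aux_decomp {ℓ : ℕ} (hℓ : ℓ.Prime) (hodd : Odd ℓ)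
    {X : Type*} [Group X] [Finite X] (G : Subgroup X) [G.Normal]
    (hindex : (G ⊔ Subgroup.center X).index = 2) (x : X) (hx : ∃ k : ℕ, x ^ ℓ ^ k = 1) :
    ∃ a ∈ G, ∃ z ∈ auxO ℓ X, x = a * z := by
  obtain ⟨k, hk⟩ := hx
  have hxM : x ∈ G ⊔ Subgroup.center X := by
    obtain ⟨j, hj⟩ := hodd.pow (n := k)
    have h2 : x * x ∈ G ⊔ Subgroup.center X := Subgroup.mul_self_mem_of_index_two hindex x
    have h1 : (x * x) ^ j * x = 1 := by
      rw [← pow_two, ← pow_mul, ← pow_succ, ← hj, hk]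
    have : x = ((x * x) ^ j)⁻¹ := (inv_eq_of_mul_eq_one_right h1).symm
    rw [this]
    exact Subgroup.inv_mem _ (Subgroup.pow_mem _ h2 j)
  obtain ⟨g, hg, z, hz, rfl⟩ := Subgroup.mem_sup_of_normal_right.1 hxM
  obtain ⟨N, m, hm, hc⟩ := Nat.exists_eq_pow_mul_and_not_dvd (Nat.card_pos (α := X)).ne' ℓ
    hℓ.ne_one
  have hcop : Nat.Coprime (ℓ ^ k) m := Nat.Coprime.pow_left _ ((hℓ.coprime_iff_not_dvd).2 hm)
  obtain ⟨e, he1, he0⟩ := Nat.chineseRemainder hcop 1 0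
  obtain ⟨c, rfl⟩ := (Nat.modEq_zero_iff_dvd).1 he0
  have hcomm : Commute g z := Subgroup.mem_center_iff.1 hz g
  have hxe : (g * z) ^ (m * c) = g * z := by
    have : (g * z) ^ (m * c) = (g * z) ^ 1 :=
      pow_eq_pow_iff_modEq.2 (he1.of_dvd (orderOf_dvd_of_pow_eq_one hk))
    simpa using this
  refine ⟨g ^ (m * c), G.pow_mem hg _, z ^ (m * c), ⟨Subgroup.pow_mem _ hz _, N, ?_⟩, ?_⟩
  · rw [← pow_mul, show m * c * ℓ ^ N = Nat.card X * c by rw [hc]; ring, pow_mul,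
      pow_card_eq_one', one_pow]
  · rw [← hcomm.mul_pow, hxe]

theorem aux_disjoint {ℓ : ℕ} (hodd : Odd ℓ)
    {X : Type*} [Group X] (G : Subgroup X)
    (hcard : Nat.card (G ⊓ Subgroup.center X : Subgroup X) = 2)
    (z : X) (hz : z ∈ auxO ℓ X) (hG : z ∈ G) : z = 1 := by
  obtain ⟨hc, k, hk⟩ := hz
  have h2 : z ^ 2 = 1 := by
    have := pow_card_eq_one' (x := (⟨z, hG, hc⟩ : (G ⊓ Subgroup.center X : Subgroup X)))
    rw [hcard] at this
    simpa using congrArg Subtype.val this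
  obtain ⟨j, hj⟩ := hodd.pow (n := k)
  rw [hj, pow_succ, pow_mul, h2, one_pow, one_mul] at hk
  exact hk

theorem aux_O_le {ℓ : ℕ} {X : Type*} [Group X] {R : Subgroup X} (hR : IsRadicalPSubgroup ℓ R) :
    auxO ℓ X ≤ R := by
  refine hR.2 _ ?_ (auxO_pgroup ℓ X) fun n _ p hp => (auxO_normal ℓ X).conj_mem p hp n
  intro z hz
  rw [Subgroup.mem_normalizer_iff]
  intro h
  rw [← Subgroup.mem_center_iff.1 hz.1 h, mul_inv_cancel_right]

theorem aux_norm {X : Type*} [Group X] (G R O : Subgroup X) [hG : G.Normal] [hO : O.Normal]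
    (h : R = (G ⊓ R) ⊔ O) : Subgroup.normalizer (R : Set X) =
      Subgroup.normalizer ((G ⊓ R : Subgroup X) : Set X) := by
  apply le_antisymm
  · apply aux_le_normalizer
    rintro n hn p ⟨hpG, hpR⟩
    exact ⟨hG.conj_mem p hpG n, (Subgroup.mem_normalizer_iff.1 hn p).1 hpR⟩
  · apply aux_le_normalizer
    intro n hn p hp
    rw [h] at hp
    obtain ⟨a, ha, z, hz, rfl⟩ := Subgroup.mem_sup_of_normal_right.1 hp
    have hOR : O ≤ R := by rw [h]; exact le_sup_right
    have h1 := ((Subgroup.mem_normalizer_iff.1 hn a).1 ha).2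
    have h2 := hOR (hO.conj_mem z hz n)
    have := R.mul_mem h1 h2
    simpa [mul_assoc] using this

/-- Let `ℓ` be an odd prime, `G₁` a finite group with center `Z₁`, and `G ⊴ G₁` such that
`G ∩ Z₁ = Z(G)` has order `2` and `G·Z₁` has index `2` in `G₁`.  Then every `ℓ`-radical
subgroup `R₁` of `G₁` satisfies `R₁ = (G ∩ R₁)·O_ℓ(Z₁)`, where `O_ℓ(Z₁)` consists of the
elements of `Z₁` of `ℓ`-power order; and `R₁ ↦ G ∩ R₁` is a bijection from the set of
`ℓ`-radical subgroups of `G₁` onto the set of `ℓ`-radical subgroups of `G`. -/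
theorem radical_subgroups_spin_clifford {ℓ : ℕ} (hℓ : ℓ.Prime) (hodd : Odd ℓ)
    {G₁ : Type*} [Group G₁] [Finite G₁] (G : Subgroup G₁) [G.Normal]
    (hZ : G ⊓ Subgroup.center G₁ = Subgroup.centralizer (G : Set G₁) ⊓ G)
    (hcard : Nat.card (G ⊓ Subgroup.center G₁ : Subgroup G₁) = 2)
    (hindex : (G ⊔ Subgroup.center G₁).index = 2) :
    (∀ R₁ : Subgroup G₁, IsRadicalPSubgroup ℓ R₁ →
      ∀ x : G₁, x ∈ R₁ ↔
        ∃ a ∈ G ⊓ R₁, ∃ z ∈ Subgroup.center G₁, (∃ k : ℕ, z ^ ℓ ^ k = 1) ∧ x = a * z) ∧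
    Set.BijOn (fun R₁ : Subgroup G₁ => G ⊓ R₁)
      {R₁ : Subgroup G₁ | IsRadicalPSubgroup ℓ R₁}
      {S : Subgroup G₁ | IsRadicalPSubgroupIn ℓ G S} := by
  have hdec : ∀ P : Subgroup G₁, IsPGroup ℓ P → auxO ℓ G₁ ≤ P → P = (G ⊓ P) ⊔ auxO ℓ G₁ := by
    intro P hP hO
    refine le_antisymm (fun x hx => ?_) (sup_le inf_le_right hO)
    obtain ⟨a, ha, z, hz, rfl⟩ := aux_decomp hℓ hodd G hindex x (aux_pgroup_iff.1 hP x hx)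
    have haP : a ∈ P := (P.mul_mem_cancel_right (hO hz)).1 hx
    exact Subgroup.mul_mem _ (Subgroup.mem_sup_left ⟨ha, haP⟩) (Subgroup.mem_sup_right hz)
  have hrad : ∀ R : Subgroup G₁, IsRadicalPSubgroup ℓ R → R = (G ⊓ R) ⊔ auxO ℓ G₁ :=
    fun R hR => hdec R hR.1 (aux_O_le hR)
  refine ⟨?_, ?_, ?_, ?_⟩
  · intro R hR x
    constructor
    · intro hx
      rw [hrad R hR] at hx
      obtain ⟨a, ha, z, hz, rfl⟩ := Subgroup.mem_sup_of_normal_right.1 hx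
      exact ⟨a, ha, z, hz.1, hz.2, rfl⟩
    · rintro ⟨a, ha, z, hz, hk, rfl⟩
      exact R.mul_mem ha.2 (aux_O_le hR ⟨hz, hk⟩)
  · intro R hR
    have hR' : IsRadicalPSubgroup ℓ R := hR
    have hN := aux_norm G R (auxO ℓ G₁) (hrad R hR')
    refine ⟨inf_le_left, hR'.1.to_le inf_le_right, ?_⟩
    intro P hPK hP hPn
    obtain ⟨Q, hPQ, hQK, hQ, hQn⟩ := aux_core _ P hPK hP hPn
    have hQR : Q ≤ R := by
      refine hR'.2 Q ?_ hQ ?_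
      · rw [hN]
        exact hQK.trans inf_le_right
      · intro n hn p hp
        refine hQn n ?_ p hp
        rw [hN] at hn
        refine aux_le_normalizer (K := Subgroup.normalizer ((G ⊓ R : Subgroup G₁) : Set G₁)) ?_ hn
        rintro k hk q ⟨hq1, hq2⟩
        exact ⟨Subgroup.Normal.conj_mem inferInstance q hq1 k,
          Subgroup.mul_mem _ (Subgroup.mul_mem _ hk hq2) (Subgroup.inv_mem _ hk)⟩
    exact le_inf (hPK.trans inf_le_left) (hPQ.trans hQR)
  · intro R hR R' hR' h
    have h' : G ⊓ R = G ⊓ R' := h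
    rw [hrad R hR, hrad R' hR', h']
  · intro S hS
    obtain ⟨hSG, hSp, hSr⟩ := (hS : IsRadicalPSubgroupIn ℓ G S)
    have hGR : G ⊓ (S ⊔ auxO ℓ G₁) = S := by
      refine le_antisymm ?_ (le_inf hSG le_sup_left)
      rintro x ⟨hxG, hx⟩
      obtain ⟨a, ha, z, hz, rfl⟩ := Subgroup.mem_sup_of_normal_right.1 hx
      have hzG : z ∈ G := (G.mul_mem_cancel_left (hSG ha)).1 hxG
      rw [aux_disjoint hodd G hcard z hz hzG, mul_one]
      exact ha
    have hN := aux_norm G (S ⊔ auxO ℓ G₁) (auxO ℓ G₁) (by rw [hGR])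
    rw [hGR] at hN
    refine ⟨S ⊔ auxO ℓ G₁, ⟨hSp.to_sup_of_normal_right (auxO_pgroup ℓ G₁), ?_⟩, hGR⟩
    intro P hPN hP hPn
    rw [hN] at hPN hPn
    have hP' : IsPGroup ℓ (P ⊔ auxO ℓ G₁ : Subgroup G₁) :=
      hP.to_sup_of_normal_right (auxO_pgroup ℓ G₁)
    have hON : auxO ℓ G₁ ≤ Subgroup.normalizer (S : Set G₁) := by
      rw [← hN]
      exact le_sup_right.trans Subgroup.le_normalizer
    have hQS : G ⊓ (P ⊔ auxO ℓ G₁) ≤ S := by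
      refine hSr _ (inf_le_inf_left _ (sup_le hPN hON)) (hP'.to_le inf_le_right) ?_
      rintro n ⟨hnG, hnN⟩ p ⟨hpG, hp⟩
      refine ⟨Subgroup.Normal.conj_mem inferInstance p hpG n, ?_⟩
      obtain ⟨a, ha, z, hz, rfl⟩ := Subgroup.mem_sup_of_normal_right.1 hp
      have := Subgroup.mul_mem _ (Subgroup.mem_sup_left (T := auxO ℓ G₁) (hPn n hnN a ha))
        (Subgroup.mem_sup_right (S := P) ((auxO_normal ℓ G₁).conj_mem z hz n))
      simpa [mul_assoc] using this
    calc P ≤ P ⊔ auxO ℓ G₁ := le_sup_left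
      _ = (G ⊓ (P ⊔ auxO ℓ G₁)) ⊔ auxO ℓ G₁ := hdec _ hP' le_sup_right
      _ ≤ S ⊔ auxO ℓ G₁ := sup_le_sup_right hQS _
end

section
/- Let ℓ be an odd prime, G̃ a finite group with center Z̃, and G a normal subgroup of G̃ such that G ∩ Z̃ = Z(G) has order 2 and the subgroup G·Z̃ has index 2 in G̃. Then for every ℓ-radical subgroup R̃ of G̃ one has C_{G̃}(R̃) = C_{G̃}(G ∩ R̃) and N_{G̃}(R̃) = N_{G̃}(G ∩ R̃); consequently C_G(G ∩ R̃) = G ∩ C_{G̃}(R̃) and N_G(G ∩ R̃) = G ∩ N_{G̃}(R̃). -/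
theorem radical_decomp {ℓ : ℕ} (hodd : Odd ℓ)
    {G₁ : Type*} [Group G₁] (G : Subgroup G₁) [G.Normal]
    (hcard : Nat.card (G ⊓ Subgroup.center G₁ : Subgroup G₁) = 2)
    (hindex : (G ⊔ Subgroup.center G₁).index = 2)
    (R₁ : Subgroup G₁) (hrad : IsRadicalPSubgroup ℓ R₁) (r : G₁) (hr : r ∈ R₁) :
    ∃ a ∈ G ⊓ R₁, ∃ z ∈ Subgroup.center G₁, z ∈ R₁ ∧ r = a * z := by
  obtain ⟨hp, hmax⟩ := hrad
  obtain ⟨k, hk⟩ := hp ⟨r, hr⟩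
  have hk : r ^ ℓ ^ k = 1 := by simpa [Subtype.ext_iff] using hk
  obtain ⟨m, hm⟩ : Odd (ℓ ^ k) := hodd.pow
  have hre : (r ^ 2) ^ (m + 1) = r := by
    rw [← pow_mul, show 2 * (m + 1) = ℓ ^ k + 1 by omega, pow_succ, hk, one_mul]
  have hmem : r ∈ G ⊔ Subgroup.center G₁ := by
    rw [← hre]
    exact Subgroup.pow_mem _ (Subgroup.sq_mem_of_index_two hindex r) _
  obtain ⟨g, hg, z, hz, hgz⟩ := Subgroup.mem_sup_of_normal_left.1 hmem
  have hc : Commute g z := Subgroup.mem_center_iff.1 hz g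
  have h1 : g ^ ℓ ^ k * z ^ ℓ ^ k = 1 := by rw [← hc.mul_pow, hgz, hk]
  have h2 : z ^ ℓ ^ k ∈ G ⊓ Subgroup.center G₁ := by
    refine ⟨?_, Subgroup.pow_mem _ hz _⟩
    rw [← inv_eq_of_mul_eq_one_right h1]
    exact G.inv_mem (G.pow_mem hg _)
  have h3 : (z ^ ℓ ^ k) ^ 2 = 1 := by
    have := pow_card_eq_one' (x := (⟨_, h2⟩ : (G ⊓ Subgroup.center G₁ : Subgroup G₁)))
    rw [hcard] at this
    simpa [Subtype.ext_iff] using this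
  have hwc : z ^ (2 * (m + 1)) ∈ Subgroup.center G₁ := Subgroup.pow_mem _ hz _
  have h4 : (z ^ (2 * (m + 1))) ^ ℓ ^ k = 1 := by
    rw [← pow_mul, show 2 * (m + 1) * ℓ ^ k = ℓ ^ k * 2 * (m + 1) by ring, pow_mul, pow_mul, h3,
      one_pow]
  have hsub : Subgroup.zpowers (z ^ (2 * (m + 1))) ≤ Subgroup.center G₁ := by
    rwa [Subgroup.zpowers_le]
  have hw : z ^ (2 * (m + 1)) ∈ R₁ := by
    refine hmax (Subgroup.zpowers (z ^ (2 * (m + 1)))) ?_ ?_ ?_ (Subgroup.mem_zpowers _)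
    · intro x hx
      rw [Subgroup.mem_normalizer_iff]
      intro y
      rw [← Subgroup.mem_center_iff.1 (hsub hx) y, mul_inv_cancel_right]
    · rintro ⟨x, hx⟩
      obtain ⟨i, rfl⟩ := hx
      refine ⟨k, Subtype.ext ?_⟩
      change ((z ^ (2 * (m + 1))) ^ i) ^ ℓ ^ k = 1
      rw [← zpow_natCast, zpow_comm, zpow_natCast, h4, one_zpow]
    · intro n _ p hp
      rwa [Subgroup.mem_center_iff.1 (hsub hp) n, mul_inv_cancel_right]
  have hr' : r = g ^ (2 * (m + 1)) * z ^ (2 * (m + 1)) := by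
    rw [← hc.mul_pow, hgz, pow_mul, hre]
  refine ⟨g ^ (2 * (m + 1)), ⟨G.pow_mem hg _, ?_⟩, _, hwc, hw, hr'⟩
  change g ^ (2 * (m + 1)) ∈ R₁
  rw [eq_mul_inv_iff_mul_eq.2 hr'.symm]
  exact R₁.mul_mem hr (R₁.inv_mem hw)

/-- Let `ℓ` be an odd prime, `G₁` a finite group with center `Z₁`, and `G ⊴ G₁` such that
`G ∩ Z₁ = Z(G)` has order `2` and `G·Z₁` has index `2` in `G₁`.  Then for every `ℓ`-radical
subgroup `R₁` of `G₁` one has `C_{G₁}(R₁) = C_{G₁}(G ∩ R₁)` and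
`N_{G₁}(R₁) = N_{G₁}(G ∩ R₁)`; consequently `C_G(G ∩ R₁) = G ∩ C_{G₁}(R₁)` and
`N_G(G ∩ R₁) = G ∩ N_{G₁}(R₁)`. -/
theorem centralizer_normalizer_radical_spin_clifford {ℓ : ℕ} (hℓ : ℓ.Prime) (hodd : Odd ℓ)
    {G₁ : Type*} [Group G₁] [Finite G₁] (G : Subgroup G₁) [G.Normal]
    (hZ : G ⊓ Subgroup.center G₁ = Subgroup.centralizer (G : Set G₁) ⊓ G)
    (hcard : Nat.card (G ⊓ Subgroup.center G₁ : Subgroup G₁) = 2)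
    (hindex : (G ⊔ Subgroup.center G₁).index = 2)
    (R₁ : Subgroup G₁) (hrad : IsRadicalPSubgroup ℓ R₁) :
    Subgroup.centralizer (R₁ : Set G₁) =
      Subgroup.centralizer ((G ⊓ R₁ : Subgroup G₁) : Set G₁) ∧
    Subgroup.normalizer (R₁ : Set G₁) =
      Subgroup.normalizer ((G ⊓ R₁ : Subgroup G₁) : Set G₁) ∧
    G ⊓ Subgroup.centralizer ((G ⊓ R₁ : Subgroup G₁) : Set G₁) =
      G ⊓ Subgroup.centralizer (R₁ : Set G₁) ∧
    G ⊓ Subgroup.normalizer ((G ⊓ R₁ : Subgroup G₁) : Set G₁) =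
      G ⊓ Subgroup.normalizer (R₁ : Set G₁) := by
  have hdec := radical_decomp hodd G hcard hindex R₁ hrad
  have hC : Subgroup.centralizer (R₁ : Set G₁) =
      Subgroup.centralizer ((G ⊓ R₁ : Subgroup G₁) : Set G₁) := by
    apply le_antisymm
    · exact Subgroup.centralizer_le (fun x hx => hx.2)
    · intro x hx
      rw [Subgroup.mem_centralizer_iff] at hx ⊢
      intro r hr
      obtain ⟨a, ha, z, hz, -, rfl⟩ := hdec r hr
      rw [mul_assoc, ← Subgroup.mem_center_iff.1 hz x, ← mul_assoc, hx a ha, mul_assoc]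
  have hN : Subgroup.normalizer (R₁ : Set G₁) =
      Subgroup.normalizer ((G ⊓ R₁ : Subgroup G₁) : Set G₁) := by
    have key : ∀ x ∈ Subgroup.normalizer ((G ⊓ R₁ : Subgroup G₁) : Set G₁), ∀ r ∈ R₁,
        x * r * x⁻¹ ∈ R₁ := by
      intro x hx r hr
      obtain ⟨a, ha, z, hz, hzR, rfl⟩ := hdec r hr
      have h := (Subgroup.mem_normalizer_iff.1 hx a).1 ha
      have e : x * (a * z) * x⁻¹ = (x * a * x⁻¹) * z := by
        rw [mul_assoc x, mul_assoc a, ← Subgroup.mem_center_iff.1 hz x⁻¹]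
        group
      rw [e]
      exact R₁.mul_mem h.2 hzR
    apply le_antisymm
    · intro x hx
      rw [Subgroup.mem_normalizer_iff] at hx ⊢
      intro h
      have hGn : h ∈ G ↔ x * h * x⁻¹ ∈ G :=
        ⟨fun hh => Subgroup.Normal.conj_mem inferInstance h hh x, fun hh => by
          have := Subgroup.Normal.conj_mem (H := G) inferInstance _ hh x⁻¹
          simpa [mul_assoc] using this⟩
      exact and_congr hGn (hx h)
    · intro x hx
      rw [Subgroup.mem_normalizer_iff]
      refine fun h => ⟨key x hx h, fun hh => ?_⟩
      have := key x⁻¹ (Subgroup.inv_mem _ hx) _ hh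
      simpa [mul_assoc] using this
  exact ⟨hC, hN, by rw [hC], by rw [hN]⟩
end
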